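/- For every integer n ≥ 1, the 2n-th secant number satisfies E_{2n} = (−1)^n · (√2 / 2^n) · ∑_{l=1}^{2n} cos(((n − l + 1/2)/2)·π) · Ā(2n+1, l). -/

import Mathlib

open Finset Filter Real

/-- The number of cyclic descents of a permutation `σ` of `{0, …, n-1}`, read cyclically:
positions `i` with `σ(i) > σ(i+1)`, indices mod `n`. -/
def cyclicDescents (n : ℕ) (σ : Equiv.Perm (Fin n)) : ℕ :=
  (Finset.univ.filter (fun i : Fin n => σ (finRotate n i) < σ i)).card

/-- The circular Eulerian number `Ā(n,l)`: the number of circular `n`-permutations with exactly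
`l` descents.  Each circular permutation has exactly `n` linear representatives (all with the
same number of cyclic descents), whence the division by `n`. -/
def circEulerian (n l : ℕ) : ℕ :=
  (Finset.univ.filter (fun σ : Equiv.Perm (Fin n) => cyclicDescents n σ = l)).card / n

open Polynomial in
/-- Eulerian-type polynomials. -/
noncomputable def Eu : ℕ → Polynomial ℤ
  | 0 => 1
  | k + 1 => X * ((1 - X) * derivative (Eu k) + ((k : Polynomial ℤ) + 1) * Eu k)

lemma cdes_eq (n : ℕ) (σ : Equiv.Perm (Fin (n + 1))) :
    cyclicDescents (n + 1) σ = ∑ i : Fin (n + 1), if σ (i + 1) < σ i then 1 else 0 := by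
  unfold cyclicDescents
  rw [Finset.card_filter]
  simp only [finRotate_apply]

lemma cdes_rot (n : ℕ) (σ : Equiv.Perm (Fin (n + 1))) (j : Fin (n + 1)) :
    cyclicDescents (n + 1) (σ * Equiv.addRight j) = cyclicDescents (n + 1) σ := by
  rw [cdes_eq, cdes_eq]
  refine Fintype.sum_equiv (Equiv.addRight j) _ _ fun i => ?_
  have h : i + 1 + j = i + j + 1 := by abel
  simp only [Equiv.Perm.mul_apply, Equiv.coe_addRight, h]
  congr

lemma sum_rot {M : Type*} [AddCommMonoid M] (n : ℕ) (j : Fin (n + 1))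
    (F : Equiv.Perm (Fin (n + 1)) → M) :
    ∑ σ, F (σ * Equiv.addRight j) = ∑ σ, F σ :=
  Fintype.sum_equiv (Equiv.mulRight (Equiv.addRight j)) _ _ fun _ => rfl

lemma cdes_insert (n : ℕ) (e : Equiv.Perm (Fin (n + 1))) :
    cyclicDescents (n + 2) (Equiv.Perm.decomposeFin.symm (0, e)) +
      (if e 0 < e (Fin.last n) then 1 else 0) = 1 + cyclicDescents (n + 1) e := by
  rw [cdes_eq, cdes_eq, Fin.sum_univ_succ, Fin.sum_univ_castSucc, Fin.sum_univ_castSucc]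
  have h1 : ∀ i : Fin n, (i.castSucc.succ + 1 : Fin (n + 2)) = i.succ.succ := by
    intro i
    rw [Fin.succ_castSucc, Fin.coeSucc_eq_succ]
  have h2 : ∀ i : Fin n, (i.castSucc + 1 : Fin (n + 1)) = i.succ := by
    intro i
    rw [Fin.coeSucc_eq_succ]
  have h3 : ((Fin.last n).succ + 1 : Fin (n + 2)) = 0 := by
    rw [Fin.succ_last, Fin.last_add_one]
  have h4 : (0 + 1 : Fin (n + 2)) = Fin.succ 0 := by simp
  simp only [h1, h2, h3, h4, Equiv.Perm.decomposeFin_symm_apply_succ,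
    Equiv.Perm.decomposeFin_symm_apply_zero, Equiv.swap_self, Equiv.refl_apply, Fin.succ_lt_succ_iff,
    Fin.last_add_one, Fin.not_lt_zero, Fin.succ_pos, if_true, if_false]
  ring

open Polynomial in
/-- Generating polynomial of cyclic descents. -/
noncomputable def PP (n : ℕ) : Polynomial ℤ :=
  ∑ σ : Equiv.Perm (Fin n), X ^ cyclicDescents n σ

open Polynomial in
noncomputable def RR (n : ℕ) : Polynomial ℤ :=
  ∑ e : Equiv.Perm (Fin (n + 1)),
    X ^ cyclicDescents (n + 2) (Equiv.Perm.decomposeFin.symm (0, e))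

open Polynomial in
lemma PP_eq_RR (n : ℕ) : PP (n + 2) = ((n : Polynomial ℤ) + 2) * RR n := by
  have h1 : PP (n + 2) = ∑ j : Fin (n + 2), ∑ σ : Equiv.Perm (Fin (n + 2)),
      if σ j = 0 then (X : Polynomial ℤ) ^ cyclicDescents (n + 2) σ else 0 := by
    rw [Finset.sum_comm, PP]
    refine Finset.sum_congr rfl fun σ _ => ?_
    simp only [← Equiv.eq_symm_apply]
    simp
  have h2 : ∀ j : Fin (n + 2), (∑ σ : Equiv.Perm (Fin (n + 2)),
      if σ j = 0 then (X : Polynomial ℤ) ^ cyclicDescents (n + 2) σ else 0) = RR n := by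
    intro j
    rw [← sum_rot (n + 1) (-j)]
    simp only [cdes_rot, Equiv.Perm.mul_apply, Equiv.coe_addRight, add_neg_cancel]
    rw [← Equiv.sum_comp Equiv.Perm.decomposeFin.symm, Fintype.sum_prod_type]
    simp only [Equiv.Perm.decomposeFin_symm_apply_zero]
    rw [Finset.sum_eq_single 0]
    · simp [RR]
    · intro b _ hb
      simp [hb]
    · simp
  rw [h1]
  simp only [h2]
  simp

open Polynomial in
lemma RR_eq (n : ℕ) : ((n : Polynomial ℤ) + 1) * RR n =
    X * ((1 - X) * derivative (PP (n + 1)) + ((n : Polynomial ℤ) + 1) * PP (n + 1)) := by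
  have h1 : ((n : Polynomial ℤ) + 1) * RR n = ∑ e : Equiv.Perm (Fin (n + 1)),
      ∑ i : Fin (n + 1), (if e (i + 1) < e i then (X : Polynomial ℤ) ^ cyclicDescents (n + 1) e
        else X ^ (cyclicDescents (n + 1) e + 1)) := by
    rw [Finset.sum_comm]
    have : ∀ i : Fin (n + 1), (∑ e : Equiv.Perm (Fin (n + 1)),
        (if e (i + 1) < e i then (X : Polynomial ℤ) ^ cyclicDescents (n + 1) e
        else X ^ (cyclicDescents (n + 1) e + 1))) = RR n := by
      intro i
      rw [← sum_rot n (Fin.last n - i)]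
      simp only [cdes_rot, Equiv.Perm.mul_apply, Equiv.coe_addRight]
      have a1 : i + 1 + (Fin.last n - i) = 0 := by
        rw [show i + 1 + (Fin.last n - i) = Fin.last n + 1 by abel, Fin.last_add_one]
      have a2 : i + (Fin.last n - i) = Fin.last n := by abel
      rw [a1, a2, RR]
      refine Finset.sum_congr rfl fun e _ => ?_
      have := cdes_insert n e
      split_ifs at this ⊢
      · congr 1; omega
      · congr 1; omega
    simp only [this]
    simp
  have h2 : ∀ e : Equiv.Perm (Fin (n + 1)),
      ∑ i : Fin (n + 1), (if e (i + 1) < e i then (X : Polynomial ℤ) ^ cyclicDescents (n + 1) e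
        else X ^ (cyclicDescents (n + 1) e + 1)) =
      X * ((1 - X) * derivative (X ^ cyclicDescents (n + 1) e)
        + ((n : Polynomial ℤ) + 1) * X ^ cyclicDescents (n + 1) e) := by
    intro e
    have : ∀ i : Fin (n + 1), (if e (i + 1) < e i then (X : Polynomial ℤ) ^ cyclicDescents (n + 1) e
        else X ^ (cyclicDescents (n + 1) e + 1)) = X ^ (cyclicDescents (n + 1) e + 1) +
        ((if e (i + 1) < e i then 1 else 0 : ℕ) : Polynomial ℤ) *
        (X ^ cyclicDescents (n + 1) e * (1 - X)) := by
      intro i; split_ifs <;> simp <;> ring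
    simp only [this]
    rw [Finset.sum_add_distrib, ← Finset.sum_mul, ← Nat.cast_sum, ← cdes_eq]
    simp only [derivative_X_pow, sum_const, Finset.card_univ, Fintype.card_fin, nsmul_eq_mul]
    rcases cyclicDescents (n + 1) e with _ | d
    · simp; ring
    · simp; ring
  rw [h1]
  simp only [h2]
  rw [← Finset.mul_sum, Finset.sum_add_distrib, ← Finset.mul_sum, ← Finset.mul_sum,
    ← derivative_sum, PP]

open Polynomial in
lemma PP_eq_Eu (k : ℕ) : PP (k + 1) = ((k : Polynomial ℤ) + 1) * Eu k := by
  induction k with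
  | zero =>
    have : ∀ σ : Equiv.Perm (Fin 1), cyclicDescents 1 σ = 0 := by
      intro σ
      rw [cdes_eq]
      simp
    simp [PP, Eu, this]
  | succ k ih =>
    rw [PP_eq_RR]
    have h := RR_eq k
    rw [ih] at h
    have hk : ((k : Polynomial ℤ) + 1) ≠ 0 := by exact_mod_cast Nat.succ_ne_zero k
    have : RR k = Eu (k + 1) := by
      apply mul_left_cancel₀ hk
      rw [h, Eu]
      have : derivative (((k : Polynomial ℤ) + 1) * Eu k) =
          ((k : Polynomial ℤ) + 1) * derivative (Eu k) := by
        simp [derivative_mul]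
      rw [this]; ring
    rw [this]; push_cast; ring

lemma circ_eq_coeff (k l : ℕ) : (circEulerian (k + 1) l : ℤ) = (Eu k).coeff l := by
  have h := congrArg (fun p => Polynomial.coeff p l) (PP_eq_Eu k)
  have hc : ((k : Polynomial ℤ) + 1) = Polynomial.C ((k : ℤ) + 1) := by simp
  simp only [hc, Polynomial.coeff_C_mul] at h
  rw [PP, Polynomial.finsetSum_coeff] at h
  simp only [Polynomial.coeff_X_pow] at h
  unfold circEulerian
  rw [Finset.card_filter]
  push_cast
  simp only [eq_comm (b := l)]
  rw [h]
  exact Int.mul_ediv_cancel_left _ (by positivity)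

lemma Eu_coeff_big (k : ℕ) : ∀ l, k < l → (Eu k).coeff l = 0 := by
  induction k with
  | zero => intro l hl; simp [Eu, Polynomial.coeff_one]; omega
  | succ k ih =>
    intro l hl
    obtain ⟨l, rfl⟩ : ∃ m, l = m + 2 := ⟨l - 2, by omega⟩
    have hc : ((k : Polynomial ℤ) + 1) = Polynomial.C ((k : ℤ) + 1) := by simp
    rw [Eu, Polynomial.coeff_X_mul, Polynomial.coeff_add, hc, Polynomial.coeff_C_mul, sub_mul,
      Polynomial.coeff_sub, one_mul, Polynomial.coeff_X_mul, Polynomial.coeff_derivative,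
      Polynomial.coeff_derivative, ih _ (by omega), ih _ (by omega)]
    simp

lemma Eu_coeff_zero (k : ℕ) : (Eu (k + 1)).coeff 0 = 0 := by
  rw [Eu]; simp

lemma Eu_aeval (n : ℕ) (hn : 1 ≤ n) (x : ℂ) : Polynomial.aeval x (Eu (2 * n)) =
    ∑ l ∈ Finset.Icc 1 (2 * n), (circEulerian (2 * n + 1) l : ℂ) * x ^ l := by
  have hd : (Eu (2 * n)).natDegree < 2 * n + 1 := by
    rw [Nat.lt_succ_iff, Polynomial.natDegree_le_iff_coeff_eq_zero]
    exact Eu_coeff_big _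
  rw [Polynomial.aeval_eq_sum_range' hd, Finset.range_eq_Ico,
    Finset.sum_eq_sum_Ico_succ_bot (by omega)]
  have h0 : (Eu (2 * n)).coeff 0 = 0 := by
    obtain ⟨m, hm⟩ : ∃ m, 2 * n = m + 1 := ⟨2 * n - 1, by omega⟩
    rw [hm, Eu_coeff_zero]
  rw [h0]
  simp only [zero_smul, zero_add]
  refine Finset.sum_congr ?_ fun l _ => ?_
  · ext; simp
  · rw [← circ_eq_coeff]
    simp

noncomputable def GG (c : ℂ) (n : ℕ) (t : ℝ) : ℂ :=
  Polynomial.aeval (c * Complex.exp (t * Complex.I)) (Eu n) /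
    (1 - c * Complex.exp (t * Complex.I)) ^ (n + 1)

lemma GG_deriv (c : ℂ) (n : ℕ) (t : ℝ) (h : 1 - c * Complex.exp (t * Complex.I) ≠ 0) :
    HasDerivAt (GG c n) (Complex.I * GG c (n + 1) t) t := by
  have hx : HasDerivAt (fun t : ℝ => c * Complex.exp (t * Complex.I))
      (c * (Complex.exp (t * Complex.I) * Complex.I)) t := by
    have h0 : HasDerivAt (fun t : ℝ => (t : ℂ) * Complex.I) Complex.I t := by
      simpa using (Complex.ofRealCLM.hasDerivAt (x := t)).mul_const Complex.I
    exact (h0.cexp).const_mul c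
  have hp := ((Eu n).hasDerivAt_aeval (c * Complex.exp (t * Complex.I))).comp t hx
  have hd := (hx.const_sub 1).fun_pow (n + 1)
  have := hp.div hd (pow_ne_zero _ h)
  refine this.congr_deriv ?_
  unfold GG
  simp only [Function.comp, Eu, map_mul, map_add, map_sub, Polynomial.aeval_X, map_one, map_natCast]
  generalize hX : Complex.exp (t * Complex.I) = w at *
  field_simp
  push_cast
  ring

lemma ev_ne (c : ℂ) (hc : c ≠ 1) : ∀ᶠ t : ℝ in nhds 0, 1 - c * Complex.exp (t * Complex.I) ≠ 0 := by
  have : ContinuousAt (fun t : ℝ => 1 - c * Complex.exp (t * Complex.I)) 0 := by fun_prop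
  apply this.eventually_ne
  simpa [sub_eq_zero] using hc.symm

lemma sec_deriv (n : ℕ) : iteratedDeriv n (fun t : ℝ => 1 / Real.cos t) =ᶠ[nhds 0]
    fun t => (Complex.I ^ (n + 1) * (GG (-Complex.I) n t - GG Complex.I n t)).re := by
  have e1 := ev_ne (-Complex.I) (by simp [Complex.ext_iff])
  have e2 := ev_ne (Complex.I) (by simp [Complex.ext_iff])
  induction n with
  | zero =>
    filter_upwards [e1, e2] with t h1 h2
    rw [iteratedDeriv_zero]
    have : ((1 / Real.cos t : ℝ) : ℂ) =
        (Complex.I ^ (0 + 1) * (GG (-Complex.I) 0 t - GG Complex.I 0 t)) := by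
      unfold GG
      push_cast
      simp only [Eu, map_one]
      rw [Complex.cos, show -(t : ℂ) * Complex.I = -(t * Complex.I) by ring, Complex.exp_neg]
      have hw := Complex.exp_ne_zero (t * Complex.I)
      generalize Complex.exp (t * Complex.I) = w at *
      have h3 : (1 - -Complex.I * w) * (1 - Complex.I * w) = 1 + w ^ 2 := by
        linear_combination (-w ^ 2) * Complex.I_sq
      have h4 : 1 + w ^ 2 ≠ 0 := by rw [← h3]; exact mul_ne_zero h1 h2
      have h5 : w + w⁻¹ = (1 + w ^ 2) / w := by field_simp; ring
      rw [pow_one, pow_one, pow_one, div_sub_div _ _ h1 h2, h3, h5]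
      field_simp
      linear_combination (2 * w) * Complex.I_sq
    rw [← this, Complex.ofReal_re]
  | succ n ih =>
    rw [iteratedDeriv_succ]
    refine ih.deriv.trans ?_
    filter_upwards [e1, e2] with t h1 h2
    have := ((GG_deriv _ n t h1).sub (GG_deriv _ n t h2)).const_mul (Complex.I ^ (n + 1))
    have h := (Complex.reCLM.hasFDerivAt.comp_hasDerivAt t this).deriv
    refine Eq.trans h ?_
    simp only [Complex.reCLM_apply]
    congr 1
    ring

lemma E_eq (E : ℕ → ℝ)
    (hE : ∃ ε > (0 : ℝ), ∀ t : ℝ, |t| < ε →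
      HasSum (fun k : ℕ => (-1) ^ k * E (2 * k) * t ^ (2 * k) / (Nat.factorial (2 * k) : ℝ))
        (1 / Real.cos t)) (n : ℕ) :
    (-1) ^ n * E (2 * n) = iteratedDeriv (2 * n) (fun t : ℝ => 1 / Real.cos t) 0 := by
  obtain ⟨ε, hε, h⟩ := hE
  let a : ℕ → ℝ := fun m => if Even m then (-1) ^ (m / 2) * E m / (Nat.factorial m : ℝ) else 0
  have h1 : HasFPowerSeriesAt (fun t : ℝ => 1 / Real.cos t)
      (FormalMultilinearSeries.ofScalars ℝ a) 0 := by
    rw [hasFPowerSeriesAt_iff]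
    filter_upwards [Metric.ball_mem_nhds (0 : ℝ) hε] with t ht
    have ht' := h t (by simpa using ht)
    rw [zero_add]
    have hinj : Function.Injective (fun k : ℕ => 2 * k) := fun a b hab => by simpa using hab
    rw [← hinj.hasSum_iff]
    · have hfun : ((fun m => t ^ m • (FormalMultilinearSeries.ofScalars ℝ a).coeff m) ∘
          fun k : ℕ => 2 * k) = fun k : ℕ =>
          (-1) ^ k * E (2 * k) * t ^ (2 * k) / (Nat.factorial (2 * k) : ℝ) := by
        funext k
        simp [a, FormalMultilinearSeries.coeff_ofScalars]
        ring
      rw [hfun]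
      exact ht'
    · intro m hm
      have : ¬ Even m := by
        rintro ⟨k, hk⟩
        exact hm ⟨k, by simp; omega⟩
      simp [a, this, FormalMultilinearSeries.coeff_ofScalars]
  have h2 := h1.analyticAt.hasFPowerSeriesAt
  have h3 := congrArg (fun p => FormalMultilinearSeries.coeff p (2 * n))
    (h1.eq_formalMultilinearSeries h2)
  simp only [FormalMultilinearSeries.coeff_ofScalars, a] at h3
  have hf : (Nat.factorial (2 * n) : ℝ) ≠ 0 := by positivity
  simp only [even_two_mul, if_true] at h3
  rw [div_left_inj' hf] at h3
  rw [← h3]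
  simp

lemma term_eq (n l : ℕ) :
    (Complex.I ^ (2 * n + 1) * ((-Complex.I) ^ l / (1 + Complex.I) ^ (2 * n + 1)
      - Complex.I ^ l / (1 - Complex.I) ^ (2 * n + 1))).re =
    Real.sqrt 2 / 2 ^ n * Real.cos ((((n : ℝ) - (l : ℝ) + 1 / 2) / 2) * π) := by
  have hs : (Real.sqrt 2 : ℂ) * Real.sqrt 2 = 2 := by
    rw [← Complex.ofReal_mul, Real.mul_self_sqrt (by norm_num)]; norm_num
  have hs0 : (Real.sqrt 2 : ℂ) ≠ 0 := by
    intro h; rw [h] at hs; norm_num at hs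
  set s : ℂ := (Real.sqrt 2 : ℂ) with hsdef
  set u : ℂ := Complex.exp ((π / 4 : ℝ) * Complex.I) with hu
  have hu' : u = s / 2 + s / 2 * Complex.I := by
    rw [hu, Complex.exp_mul_I, ← Complex.ofReal_cos, ← Complex.ofReal_sin, Real.cos_pi_div_four,
      Real.sin_pi_div_four]; push_cast; ring
  have hu0 : u ≠ 0 := Complex.exp_ne_zero _
  have hI : Complex.I = u ^ 2 := by
    rw [hu']; linear_combination (-Complex.I / 2 - 1/4 - Complex.I^2/4) * hs - 1/2 * Complex.I_sq
  have h8 : u ^ 4 = -1 := by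
    rw [show u ^ 4 = (u ^ 2) ^ 2 by ring, ← hI, Complex.I_sq]
  have hp : 1 + Complex.I = s * u := by
    rw [hu']; linear_combination (-1 / 2 - Complex.I / 2) * hs
  have hinv : u⁻¹ = -u ^ 3 := by
    field_simp; linear_combination h8
  have hm : 1 - Complex.I = s * u⁻¹ := by
    have hh : (1 - Complex.I) * (1 + Complex.I) = 2 := by linear_combination -Complex.I_sq
    have : (1 - Complex.I) * (s * u) = s * s := by rw [← hp, hh, hs]
    field_simp
    apply mul_left_cancel₀ hs0
    linear_combination this
  have hni : -Complex.I = (u⁻¹) ^ 2 := by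
    rw [hinv, hI]; linear_combination (-u ^ 2) * h8
  have hs2 : s ^ (2 * n + 1) = 2 ^ n * s := by
    rw [pow_succ, pow_mul, pow_two, hs]
  have hcos : ((Real.sqrt 2 / 2 ^ n * Real.cos ((((n : ℝ) - (l : ℝ) + 1 / 2) / 2) * π) : ℝ) : ℂ)
      = s / 2 ^ n * ((u ^ (2 * n + 1) * (u⁻¹) ^ (2 * l) + (u⁻¹) ^ (2 * n + 1) * u ^ (2 * l)) / 2) := by
    push_cast
    rw [Complex.cos, hu, ← Complex.exp_neg]
    simp only [← Complex.exp_nat_mul, ← Complex.exp_add]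
    rw [hsdef]
    congr 4 <;> congr 1 <;> push_cast <;> ring
  have key : (Complex.I ^ (2 * n + 1) * ((-Complex.I) ^ l / (1 + Complex.I) ^ (2 * n + 1)
      - Complex.I ^ l / (1 - Complex.I) ^ (2 * n + 1))) =
      ((Real.sqrt 2 / 2 ^ n * Real.cos ((((n : ℝ) - (l : ℝ) + 1 / 2) / 2) * π) : ℝ) : ℂ) := by
    rw [hcos, hp, hm, hni, hI, mul_pow, mul_pow, hs2, ← pow_mul, ← pow_mul, ← pow_mul]
    -- clear the powers
    have e1 : u ^ (2 * (2 * n + 1)) = u ^ (2 * n + 1) * u ^ (2 * n + 1) := by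
      rw [← pow_add]; congr 1; ring
    have hv : u⁻¹ ^ (2 * n + 1) * u ^ (2 * n + 1) = 1 := by
      rw [← mul_pow, inv_mul_cancel₀ hu0, one_pow]
    have hw0 : u ^ (2 * n + 1) ≠ 0 := pow_ne_zero _ hu0
    have e2 : (u ^ (2 * n + 1)) ^ 4 = -1 := by
      rw [← pow_mul, mul_comm, pow_mul, h8]
      exact Odd.neg_one_pow ⟨n, rfl⟩
    have e3 : u⁻¹ ^ (2 * n + 1) = (u ^ (2 * n + 1))⁻¹ := inv_pow _ _
    rw [e1, e3]
    generalize u ^ (2 * n + 1) = w at *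
    generalize u ^ (2 * l) = A at *
    generalize u⁻¹ ^ (2 * l) = B at *
    have e4 : w ^ 3 = - w⁻¹ := by field_simp; linear_combination e2
    have e5 : w * w * (B / (2 ^ n * s * w) - A / (2 ^ n * s * w⁻¹)) =
        (w * B - w ^ 3 * A) / (2 ^ n * s) := by field_simp
    rw [e5, e4]
    field_simp
    linear_combination -(w ^ 2 * B + A) * hs
  rw [key, Complex.ofReal_re]

/-- If `E` gives the secant numbers, i.e. `sec t = ∑_{k≥0} (-1)^k E_{2k} t^{2k}/(2k)!` near `0`,
then `E_{2n} = (-1)^n (√2 / 2^n) ∑_{l=1}^{2n} cos(((n - l + 1/2)/2) π) Ā(2n+1, l)`. -/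
theorem secant_number_eq_circEulerian_sum (E : ℕ → ℝ)
    (hE : ∃ ε > (0 : ℝ), ∀ t : ℝ, |t| < ε →
      HasSum (fun k : ℕ => (-1) ^ k * E (2 * k) * t ^ (2 * k) / (Nat.factorial (2 * k) : ℝ))
        (1 / Real.cos t))
    (n : ℕ) (hn : 1 ≤ n) :
    E (2 * n) = (-1) ^ n * (Real.sqrt 2 / 2 ^ n) *
      ∑ l ∈ Finset.Icc 1 (2 * n),
        Real.cos ((((n : ℝ) - (l : ℝ) + 1 / 2) / 2) * π) * (circEulerian (2 * n + 1) l : ℝ) := by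
  have h1 := E_eq E hE n
  rw [(sec_deriv (2 * n)).eq_of_nhds] at h1
  have h2 : (Complex.I ^ (2 * n + 1) * (GG (-Complex.I) (2 * n) 0 - GG Complex.I (2 * n) 0)).re =
      (Real.sqrt 2 / 2 ^ n) * ∑ l ∈ Finset.Icc 1 (2 * n),
        Real.cos ((((n : ℝ) - (l : ℝ) + 1 / 2) / 2) * π) * (circEulerian (2 * n + 1) l : ℝ) := by
    unfold GG
    simp only [Complex.ofReal_zero, zero_mul, Complex.exp_zero, mul_one, Eu_aeval n hn,
      sub_neg_eq_add]
    rw [Finset.sum_div, Finset.sum_div, ← Finset.sum_sub_distrib, Finset.mul_sum, Finset.mul_sum,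
      Complex.re_sum]
    refine Finset.sum_congr rfl fun l _ => ?_
    rw [← mul_assoc, ← term_eq, mul_comm _ (circEulerian (2 * n + 1) l : ℝ),
      ← Complex.re_ofReal_mul]
    congr 1
    push_cast
    ring
  rw [h2] at h1
  rw [mul_assoc, ← h1, ← mul_assoc, ← mul_pow]
  simp
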